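/- arXiv:1808.03052 — 2 statements merged into one kernel-verified Lean document; each statement's English description precedes it below -/
import Mathlib

section
/- Let A be a semisimple unital complex Banach algebra and a, b ∈ Soc(A). Then ρ(a,b) = 0 if and only if ρ(b,a) = 0. -/
open Filter Metric

variable {A : Type*}

/-- The operator `C_{a,b} = L_a - R_b`. -/
noncomputable def Cop [NormedRing A] [NormedAlgebra ℂ A] (a b : A) : Module.End ℂ A :=
  LinearMap.mulLeft ℂ a - LinearMap.mulRight ℂ b

/-- `ρ(a,b) = limsup_n ‖C_{a,b}^n 1‖^{1/n}`. -/
noncomputable def rho [NormedRing A] [NormedAlgebra ℂ A] (a b : A) : ℝ :=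
  Filter.limsup (fun n : ℕ => ‖(Cop a b ^ n) 1‖ ^ (1 / (n : ℝ))) Filter.atTop

/-- The spectral semidistance `d(a,b) = max{ρ(a,b), ρ(b,a)}`. -/
noncomputable def qd [NormedRing A] [NormedAlgebra ℂ A] (a b : A) : ℝ :=
  max (rho a b) (rho b a)

/-- The Riesz projection of `a` at `lam`, computed over a circle of radius `r`. -/
noncomputable def rieszP [NormedRing A] [NormedAlgebra ℂ A] (a : A) (lam : ℂ) (r : ℝ) : A :=
  ((2 * Real.pi * Complex.I : ℂ))⁻¹ •
    circleIntegral (fun z => Ring.inverse (algebraMap ℂ A z - a)) lam r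

open scoped Classical in
/-- The Riesz projection at an isolated spectral point (radius chosen by choice). -/
noncomputable def rieszIdem [NormedRing A] [NormedAlgebra ℂ A] (a : A) (lam : ℂ) : A :=
  if h : ∃ r : ℝ, 0 < r ∧ spectrum ℂ a ∩ closedBall lam r = {lam}
  then rieszP a lam h.choose else 0

/-- The Aupetit–Mouton spectral rank. -/
noncomputable def sRank [NormedRing A] [NormedAlgebra ℂ A] (a : A) : ℕ∞ :=
  ⨆ x : A, (spectrum ℂ (x * a) \ {0}).encard

/-- Spectral multiplicity at a nonzero isolated spectral point: rank of the Riesz projection. -/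
noncomputable def sMult [NormedRing A] [NormedAlgebra ℂ A] (a : A) (lam : ℂ) : ℕ :=
  (sRank (rieszIdem a lam)).toNat

/-- The Aupetit–Mouton spectral trace. -/
noncomputable def sTrace [NormedRing A] [NormedAlgebra ℂ A] (a : A) : ℂ :=
  ∑ᶠ lam ∈ spectrum ℂ a \ {0}, lam * (sMult a lam : ℂ)

/-- `det(1 + λ a)`, the Aupetit–Mouton spectral determinant. -/
noncomputable def sDet [NormedRing A] [NormedAlgebra ℂ A] (a : A) (lam : ℂ) : ℂ :=
  ∏ᶠ mu ∈ spectrum ℂ a \ {0}, (1 + lam * mu) ^ sMult a mu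

/-- The socle: the sum of all minimal left ideals. -/
def socle (A : Type*) [Ring A] : Ideal A := sSup {I : Ideal A | IsAtom I}

/-- Semisimplicity: the Jacobson radical is zero. -/
def IsSemisimpleBA (A : Type*) [Ring A] : Prop := Ideal.jacobson (⊥ : Ideal A) = ⊥

open Polynomial

section Socle

/-- Over a complex Banach algebra, an endomorphism of a simple module is a scalar. -/
lemma exists_algebraMap_eq_of_isSimpleModule [NormedRing A] [NormedAlgebra ℂ A] [CompleteSpace A]
    {M : Type*} [AddCommGroup M] [Module A M] [Module ℂ M] [IsScalarTower ℂ A M]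
    [SMulCommClass A ℂ M] [IsSimpleModule A M] (T : Module.End A M) :
    ∃ c : ℂ, algebraMap ℂ (Module.End A M) c = T := by
  obtain ⟨I, hI, ⟨e⟩⟩ := isSimpleModule_iff_quot_maximal.mp (‹IsSimpleModule A M›)
  have hcl : IsClosed (I : Set A) := Ideal.IsMaximal.isClosed
  let S : (A ⧸ I) →ₗ[A] (A ⧸ I) := e.toLinearMap ∘ₗ T ∘ₗ e.symm.toLinearMap
  have hS : Continuous S := by
    rw [(Submodule.isOpenQuotientMap_mkQ I).isQuotientMap.continuous_iff]
    obtain ⟨t, ht⟩ := Submodule.mkQ_surjective I (S (I.mkQ 1))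
    have : S ∘ I.mkQ = fun x => I.mkQ (x * t) := by
      funext x
      have hx : I.mkQ x = x • I.mkQ 1 := by rw [← map_smul, smul_eq_mul, mul_one]
      rw [Function.comp_apply, hx, map_smul, ← ht, ← map_smul, smul_eq_mul]
    rw [this]
    exact (Submodule.isOpenQuotientMap_mkQ I).continuous.comp (by fun_prop)
  let U : (A ⧸ I) →L[ℂ] (A ⧸ I) := ⟨S.restrictScalars ℂ, hS⟩
  have : Nontrivial (A ⧸ I) := Submodule.Quotient.nontrivial_iff.mpr hI.ne_top
  obtain ⟨c, hc⟩ := spectrum.nonempty U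
  refine ⟨c, ?_⟩
  rcases (algebraMap ℂ (Module.End A M) c - T).bijective_or_eq_zero with h | h
  · refine absurd ?_ hc
    rw [spectrum.mem_resolventSet_iff, ContinuousLinearMap.isUnit_iff_bijective]
    have : ⇑(algebraMap ℂ ((A ⧸ I) →L[ℂ] (A ⧸ I)) c - U)
        = e ∘ (algebraMap ℂ (Module.End A M) c - T) ∘ e.symm := by
      funext x
      have h (y : M) : e (c • y) = c • e y := by
        rw [← algebraMap_smul A c y, map_smul, algebraMap_smul]
      simp [U, S, Algebra.algebraMap_eq_smul_one, h]
    rw [this]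
    exact e.bijective.comp (h.comp e.symm.bijective)
  · exact sub_eq_zero.mp h

lemma finiteDimensional_end_of_isSimpleModule [NormedRing A] [NormedAlgebra ℂ A] [CompleteSpace A]
    {M : Type*} [AddCommGroup M] [Module A M] [Module ℂ M] [IsScalarTower ℂ A M]
    [SMulCommClass A ℂ M] [IsSimpleModule A M] : FiniteDimensional ℂ (Module.End A M) :=
  Module.Finite.of_surjective (Algebra.linearMap ℂ (Module.End A M))
    exists_algebraMap_eq_of_isSimpleModule

lemma isSemisimpleModule_socle (R : Type*) [Ring R] : IsSemisimpleModule R (socle R) := by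
  have := isSemisimpleModule_biSup_of_isSemisimpleModule_submodule
    (s := {I : Ideal R | IsAtom I}) (p := id) fun I hI => by
      have : IsSimpleModule R I := isSimpleModule_iff_isAtom.mpr hI
      exact inferInstanceAs (IsSemisimpleModule R I)
  rwa [socle, sSup_eq_iSup]

/-- Elements of the socle of a complex Banach algebra are algebraic. -/
lemma isIntegral_of_mem_socle [NormedRing A] [NormedAlgebra ℂ A] [CompleteSpace A]
    {a : A} (ha : a ∈ socle A) : IsIntegral ℂ a := by
  have := isSemisimpleModule_socle A
  let L : Ideal A := Ideal.span {a}
  have haL : a ∈ L := Ideal.mem_span_singleton_self a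
  have hL : L ≤ socle A := by simpa [L, Ideal.span_le] using ha
  have : IsSemisimpleModule A L :=
    IsSemisimpleModule.of_injective _ (Submodule.inclusion_injective hL)
  have : Module.Finite A L := Module.Finite.span_singleton A a
  have : FiniteDimensional ℂ (Module.End A L) := by
    obtain ⟨n, S, d, hS, hd, ⟨e⟩⟩ := IsSemisimpleModule.exists_end_algEquiv_pi_matrix_end ℂ A L
    have (i : Fin n) : FiniteDimensional ℂ (Module.End A (S i)) :=
      finiteDimensional_end_of_isSimpleModule
    exact Module.Finite.equiv e.symm.toLinearEquiv
  let T : Module.End A L := (LinearMap.toSpanSingleton A A a).restrict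
    fun x _ => by simpa using L.mul_mem_left x haL
  have hT (x : L) : ((T x : L) : A) = x * a := rfl
  obtain ⟨p, hp, hpT⟩ := Algebra.IsIntegral.isIntegral (R := ℂ) T
  have key (q : ℂ[X]) (x : L) : ((aeval T q x : L) : A) = x * aeval a q := by
    induction q using Polynomial.induction_on' with
    | add q r hq hr => simp [hq, hr, mul_add]
    | monomial k c =>
      have h (x : L) : (((T ^ k) x : L) : A) = x * a ^ k := by
        induction k generalizing x with
        | zero => simp
        | succ k ih => rw [pow_succ, Module.End.mul_apply, ih, hT, pow_succ', mul_assoc]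
      simp [aeval_monomial, Algebra.algebraMap_eq_smul_one, h]
  refine ⟨X * p, monic_X.mul hp, ?_⟩
  have := key p ⟨a, haL⟩
  rw [show aeval T p = 0 from hpT] at this
  rw [← aeval_def, map_mul, aeval_X]
  simpa using this.symm

end Socle

section Partition

/-- A monic complex polynomial with a root yields a partition of unity subordinate to its roots. -/
lemma exists_partition_of_monic {P : ℂ[X]} (hP : P.Monic) (h0 : P.IsRoot 0) :
    ∃ (t : Finset ℂ) (m : ℂ → ℕ) (p : ℂ → ℂ[X]), ∑ i ∈ t, p i = 1 ∧
      ∀ i ∈ t, P ∣ (X - C i) ^ m i * p i := by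
  classical
  set t := P.roots.toFinset
  set s : ℂ → ℂ[X] := fun i => (X - C i) ^ P.roots.count i
  have hprod : P = ∏ i ∈ t, s i := by
    rw [← Finset.prod_multiset_map_count]
    exact (IsAlgClosed.splits P).eq_prod_roots_of_monic hP
  have hne : t.Nonempty := ⟨0, by simpa [t, hP.ne_zero] using h0⟩
  obtain ⟨μ, hμ⟩ := (exists_sum_eq_one_iff_pairwise_coprime (s := s) hne).mpr fun i j hij =>
    (pairwise_coprime_X_sub_C Function.injective_id (Subtype.coe_injective.ne hij)).pow
  have hfac {i} (hi : i ∈ t) : P = s i * ∏ j ∈ t \ {i}, s j := by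
    rw [hprod, Finset.sdiff_singleton_eq_erase, Finset.mul_prod_erase t s hi]
  refine ⟨t, fun i => P.roots.count i, fun i => μ i * ∏ j ∈ t \ {i}, s j, hμ, fun i hi => ?_⟩
  refine ⟨μ i, ?_⟩
  conv_rhs => rw [hfac hi]
  ring

end Partition

section Cop

variable [NormedRing A] [NormedAlgebra ℂ A]

lemma Cop_apply (a b x : A) : Cop a b x = a * x - x * b := rfl

lemma Cop_pow_mul_mul {a b u v : A} (hu : Commute a u) (hv : Commute v b) (x : A) (n : ℕ) :
    (Cop a b ^ n) (u * x * v) = u * (Cop a b ^ n) x * v := by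
  induction n generalizing x with
  | zero => simp
  | succ n ih =>
    rw [pow_succ, Module.End.mul_apply, Module.End.mul_apply, ← ih]
    congr 1
    rw [Cop_apply, Cop_apply, mul_sub, sub_mul, mul_assoc _ v b, hv.eq]
    simp only [← mul_assoc, hu.eq]

lemma Cop_sub_algebraMap (a b : A) (c d : ℂ) :
    Cop (a - algebraMap ℂ A c) (b - algebraMap ℂ A d) = Cop a b - algebraMap ℂ _ (c - d) := by
  refine LinearMap.ext fun x => ?_
  simp only [Cop_apply, LinearMap.sub_apply, Module.algebraMap_end_apply,
    Algebra.algebraMap_eq_smul_one (A := A), sub_mul, mul_sub, smul_mul_assoc, mul_smul_comm,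
    one_mul, mul_one, sub_smul]
  abel

lemma Cop_pow_add_apply_eq_zero {a b v : A} {m n : ℕ} (ha : a ^ m * v = 0) (hb : v * b ^ n = 0) :
    (Cop a b ^ (m + n)) v = 0 := by
  have hc : Commute (LinearMap.mulLeft ℂ a) (-LinearMap.mulRight ℂ b) :=
    (LinearMap.commute_mulLeft_right a b).neg_right
  rw [Cop, sub_eq_add_neg, hc.add_pow, LinearMap.sum_apply]
  refine Finset.sum_eq_zero fun k _ => ?_
  rw [Module.End.mul_apply, Module.End.natCast_apply, map_nsmul]
  suffices (LinearMap.mulLeft ℂ a ^ k * (-LinearMap.mulRight ℂ b) ^ (m + n - k)) v = 0 by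
    rw [this, smul_zero]
  rcases le_total m k with h | h
  · rw [(hc.pow_pow _ _).eq, Module.End.mul_apply, LinearMap.pow_mulLeft, LinearMap.mulLeft_apply,
      ← Nat.sub_add_cancel h, pow_add, mul_assoc, ha, mul_zero, map_zero]
  · rw [Module.End.mul_apply, neg_pow, Module.End.mul_apply, LinearMap.pow_mulRight,
      LinearMap.mulRight_apply, show m + n - k = n + (m - k) by lia, pow_add b, ← mul_assoc, hb,
      zero_mul, map_zero, map_zero]

lemma norm_Cop_apply_le (a b x : A) : ‖Cop a b x‖ ≤ (‖a‖ + ‖b‖) * ‖x‖ := by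
  calc ‖a * x - x * b‖ ≤ ‖a‖ * ‖x‖ + ‖x‖ * ‖b‖ :=
        (norm_sub_le _ _).trans (add_le_add (norm_mul_le _ _) (norm_mul_le _ _))
    _ = (‖a‖ + ‖b‖) * ‖x‖ := by ring

lemma norm_Cop_pow_apply_le (a b x : A) (n : ℕ) :
    ‖(Cop a b ^ n) x‖ ≤ (‖a‖ + ‖b‖) ^ n * ‖x‖ := by
  induction n with
  | zero => simp
  | succ n ih =>
    rw [pow_succ', Module.End.mul_apply, pow_succ', mul_assoc]
    exact (norm_Cop_apply_le a b _).trans (by gcongr)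

lemma isBigO_Cop_pow_of_rho_eq_zero {a b : A} (h : rho a b = 0) {ε : ℝ} (hε : 0 < ε) :
    (fun n : ℕ => (Cop a b ^ n) 1) =O[atTop] fun n => ε ^ n := by
  have hbdd : IsBoundedUnder (· ≤ ·) atTop
      fun n : ℕ => ‖(Cop a b ^ n) 1‖ ^ (1 / (n : ℝ)) := by
    refine isBoundedUnder_of_eventually_le (a := (‖a‖ + ‖b‖) * (‖(1 : A)‖ + 1)) ?_
    filter_upwards [eventually_ne_atTop 0] with n hn
    rw [one_div, Real.rpow_inv_le_iff_of_pos (norm_nonneg _) (by positivity) (by positivity),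
      Real.rpow_natCast, mul_pow]
    refine (norm_Cop_pow_apply_le a b 1 n).trans ?_
    gcongr
    exact (le_add_of_nonneg_right zero_le_one).trans
      (le_self_pow₀ (le_add_of_nonneg_left (norm_nonneg _)) hn)
  have hlt := eventually_lt_of_limsup_lt (h.trans_lt hε) hbdd
  refine Asymptotics.IsBigO.of_bound 1 ?_
  filter_upwards [hlt, eventually_ne_atTop 0] with n hn hn0
  rw [one_div, Real.rpow_inv_lt_iff_of_pos (norm_nonneg _) hε.le (by positivity),
    Real.rpow_natCast] at hn
  rw [one_mul, Real.norm_of_nonneg (by positivity)]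
  exact hn.le

lemma rho_eq_zero_of_Cop_pow_eq_zero {a b : A} {N : ℕ} (h : (Cop a b ^ N) 1 = 0) :
    rho a b = 0 := by
  refine Tendsto.limsup_eq (tendsto_const_nhds.congr' ?_)
  filter_upwards [eventually_ge_atTop N, eventually_ne_atTop 0] with n hn hn0
  rw [← Nat.sub_add_cancel hn, pow_add, Module.End.mul_apply, h, map_zero, norm_zero,
    Nat.sub_add_cancel hn, Real.zero_rpow (by positivity)]

/-- If the powers of an operator decay superexponentially at a generalized eigenvector, then the
eigenvalue vanishes. -/
lemma eq_zero_of_isBigO_pow {E : Type*} [NormedAddCommGroup E] [NormedSpace ℂ E]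
    {T : Module.End ℂ E} {D : ℝ} (hT : ∀ x, ‖T x‖ ≤ D * ‖x‖) {c : ℂ} (hc : c ≠ 0) {M : ℕ} {v : E}
    (hM : ((T - algebraMap ℂ _ c) ^ M) v = 0)
    (hv : ∀ ε : ℝ, 0 < ε → (fun n : ℕ => (T ^ n) v) =O[atTop] fun n => ε ^ n) : v = 0 := by
  induction M generalizing v with
  | zero => simpa using hM
  | succ M ih =>
    rw [pow_succ, Module.End.mul_apply] at hM
    have hw := ih hM fun ε hε => by
      refine Asymptotics.IsBigO.trans (.of_bound (D + ‖c‖) (.of_forall fun n => ?_)) (hv ε hε)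
      have : (T ^ n) ((T - algebraMap ℂ (Module.End ℂ E) c) v) = T ((T ^ n) v) - c • (T ^ n) v := by
        rw [LinearMap.sub_apply, map_sub, Module.algebraMap_end_apply, map_smul,
          ← Module.End.mul_apply, ← pow_succ, pow_succ', Module.End.mul_apply]
      rw [this, add_mul, ← norm_smul]
      exact (norm_sub_le _ _).trans (add_le_add (hT _) le_rfl)
    have hTv : T v = c • v := by
      simpa [sub_eq_zero] using hw
    have hpow (n : ℕ) : (T ^ n) v = c ^ n • v := by
      induction n with
      | zero => simp
      | succ n ihn => rw [pow_succ, Module.End.mul_apply, hTv, map_smul, ihn, smul_smul, pow_succ']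
    obtain ⟨K, hK⟩ := (hv (‖c‖ / 2) (by positivity)).bound
    have hlim : Tendsto (fun n : ℕ => K * (1 / 2 : ℝ) ^ n) atTop (nhds 0) := by
      simpa using (tendsto_pow_atTop_nhds_zero_of_lt_one (by norm_num : (0 : ℝ) ≤ 1 / 2)
        (by norm_num)).const_mul K
    refine norm_le_zero_iff.mp (ge_of_tendsto hlim (hK.mono fun n hn => ?_))
    rw [hpow, norm_smul, norm_pow, Real.norm_of_nonneg (by positivity), div_pow] at hn
    have : 0 < ‖c‖ ^ n := by positivity
    refine le_of_mul_le_mul_left (hn.trans_eq ?_) this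
    rw [one_div, inv_pow]
    ring

end Cop

/-- For algebraic `a` and `b`, the condition `ρ(a,b) = 0` forces the spectral idempotents of `a`
and `b` to coincide, which is symmetric in `a` and `b`. -/
lemma rho_eq_zero_symm_of_isIntegral [NormedRing A] [NormedAlgebra ℂ A] {a b : A}
    (ha : IsIntegral ℂ a) (hb : IsIntegral ℂ b) (h : rho a b = 0) : rho b a = 0 := by
  let P : ℂ[X] := X * (minpoly ℂ a * minpoly ℂ b)
  have hP : P.Monic := monic_X.mul ((minpoly.monic ha).mul (minpoly.monic hb))
  have hPa {q : ℂ[X]} (hq : P ∣ q) : aeval a q = 0 :=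
    minpoly.dvd_iff.mp (((dvd_mul_right _ _).mul_left X).trans hq)
  have hPb {q : ℂ[X]} (hq : P ∣ q) : aeval b q = 0 :=
    minpoly.dvd_iff.mp (((dvd_mul_left _ _).mul_left X).trans hq)
  obtain ⟨t, m, p, hsum, hann⟩ := exists_partition_of_monic hP (by simp [P])
  have hcomm (x : A) (q : ℂ[X]) : Commute x (aeval x q) := by
    simpa using (Commute.all (X : ℂ[X]) q).map (aeval x)
  have hann' (x : A) (i : ℂ) (hx : aeval x ((X - C i) ^ m i * p i) = 0) :
      (x - algebraMap ℂ A i) ^ m i * aeval x (p i) = 0 ∧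
        aeval x (p i) * (x - algebraMap ℂ A i) ^ m i = 0 := by
    refine ⟨by simpa using hx, ?_⟩
    rw [mul_comm] at hx
    simpa using hx
  have hvanish (x y : A) (hx : ∀ q, P ∣ q → aeval x q = 0) (hy : ∀ q, P ∣ q → aeval y q = 0)
      {i j : ℂ} (hi : i ∈ t) (hj : j ∈ t) :
      ((Cop x y - algebraMap ℂ _ (i - j)) ^ (m i + m j)) (aeval x (p i) * aeval y (p j)) = 0 := by
    rw [← Cop_sub_algebraMap]
    refine Cop_pow_add_apply_eq_zero ?_ ?_
    · rw [← mul_assoc, (hann' x i (hx _ (hann i hi))).1, zero_mul]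
    · rw [mul_assoc, (hann' y j (hy _ (hann j hj))).2, mul_zero]
  have hoff {i j : ℂ} (hi : i ∈ t) (hj : j ∈ t) (hij : i ≠ j) :
      aeval a (p i) * aeval b (p j) = 0 := by
    refine eq_zero_of_isBigO_pow (norm_Cop_apply_le a b) (sub_ne_zero.mpr hij)
      (hvanish a b (fun _ => hPa) (fun _ => hPb) hi hj) fun ε hε => ?_
    refine Asymptotics.IsBigO.trans (.of_bound (‖aeval a (p i)‖ * ‖aeval b (p j)‖)
      (.of_forall fun n => ?_)) (isBigO_Cop_pow_of_rho_eq_zero h hε)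
    have := Cop_pow_mul_mul (hcomm a (p i)) (hcomm b (p j)).symm 1 n
    rw [mul_one] at this
    rw [this, mul_right_comm]
    exact (norm_mul_le _ _).trans (by gcongr; exact norm_mul_le _ _)
  have hone (x : A) : ∑ i ∈ t, aeval x (p i) = 1 := by rw [← map_sum, hsum, map_one]
  have hidem {i : ℂ} (hi : i ∈ t) : aeval b (p i) * aeval a (p i) = aeval a (p i) := by
    have h₁ : aeval a (p i) = aeval a (p i) * aeval b (p i) := by
      conv_lhs => rw [← mul_one (aeval a (p i)), ← hone b, Finset.mul_sum]
      exact Finset.sum_eq_single_of_mem i hi fun j hj hji => hoff hi hj hji.symm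
    have h₂ : aeval b (p i) = aeval a (p i) * aeval b (p i) := by
      conv_lhs => rw [← one_mul (aeval b (p i)), ← hone a, Finset.sum_mul]
      exact Finset.sum_eq_single_of_mem i hi fun j hj hji => hoff hj hi hji
    have h₃ : aeval a (p i) = aeval b (p i) := h₁.trans h₂.symm
    rw [← h₃] at h₁ ⊢
    exact h₁.symm
  have hdiag : ∑ i ∈ t, aeval b (p i) * aeval a (p i) = 1 :=
    (Finset.sum_congr rfl fun i hi => hidem hi).trans (hone a)
  refine rho_eq_zero_of_Cop_pow_eq_zero (N := ∑ i ∈ t, (m i + m i)) ?_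
  rw [← hdiag, map_sum]
  refine Finset.sum_eq_zero fun i hi => ?_
  have := hvanish b a (fun _ => hPb) (fun _ => hPa) hi hi
  rw [sub_self, map_zero, sub_zero] at this
  rw [← Finset.sum_erase_add t _ hi, pow_add, Module.End.mul_apply, this, map_zero]

theorem stmt10 [NormedRing A] [NormedAlgebra ℂ A] [CompleteSpace A]
    (hA : IsSemisimpleBA A) (a b : A) (ha : a ∈ socle A) (hb : b ∈ socle A) :
    rho a b = 0 ↔ rho b a = 0 := by
  exact ⟨rho_eq_zero_symm_of_isIntegral (isIntegral_of_mem_socle ha) (isIntegral_of_mem_socle hb),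
    rho_eq_zero_symm_of_isIntegral (isIntegral_of_mem_socle hb) (isIntegral_of_mem_socle ha)⟩
end

section
/- Let A be a semisimple unital complex Banach algebra and a, b ∈ Soc(A) with ρ(a,b) = 0. Then σ(a)∖{0} = σ(b)∖{0} and for each nonzero λ in this common set, the spectral multiplicities agree: m(λ,a) = m(λ,b). -/
open Filter Metric

variable {A : Type*}

/-- Every element of the socle lies in a left ideal of finite length. -/
lemma exists_finite_length_of_mem_socle {R : Type*} [Ring R] {x : R} (hx : x ∈ socle R) :
    ∃ J : Ideal R, x ∈ J ∧ IsNoetherian R J ∧ IsArtinian R J := by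
  rw [socle, sSup_eq_iSup'] at hx
  refine Submodule.iSup_induction _
    (motive := fun x => ∃ J : Ideal R, x ∈ J ∧ IsNoetherian R J ∧ IsArtinian R J) hx ?_ ?_ ?_
  · intro I x hx
    have : IsSimpleModule R I.1 := isSimpleModule_iff_isAtom.2 I.2
    exact ⟨I.1, hx, inferInstance, inferInstance⟩
  · exact ⟨⊥, zero_mem _, inferInstance, inferInstance⟩
  · rintro x y ⟨I, hxI, _, _⟩ ⟨J, hyJ, _, _⟩
    exact ⟨I ⊔ J, add_mem (Ideal.mem_sup_left hxI) (Ideal.mem_sup_right hyJ),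
      isNoetherian_sup I J, isArtinian_sup I J⟩

section FiniteLength

variable [Ring A] [Algebra ℂ A] {J : Ideal A} {x : A} {z : ℂ}

lemma mul_algebraMap_sub_mem (hx : x ∈ J) {y : A} (hy : y ∈ J) :
    y * (algebraMap ℂ A z - x) ∈ J := by
  rw [mul_sub, ← Algebra.commutes]
  exact J.sub_mem (J.mul_mem_left _ hy) (J.mul_mem_left _ hx)

lemma mem_of_mul_algebraMap_sub_mem (hx : x ∈ J) (hz : z ≠ 0 ∨ (1 : A) ∈ J) {y : A}
    (hy : y * (algebraMap ℂ A z - x) ∈ J) : y ∈ J := by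
  rcases hz with hz | hz
  · have h : algebraMap ℂ A z * y ∈ J := by
      rw [Algebra.commutes]
      simpa [mul_sub] using J.add_mem hy (J.mul_mem_left y hx)
    have := J.mul_mem_left (algebraMap ℂ A z⁻¹) h
    rwa [← mul_assoc, ← map_mul, inv_mul_cancel₀ hz, map_one, one_mul] at this
  · simpa using J.mul_mem_left y hz

/-- Right multiplication by `z - x` on a left ideal containing `x`. -/
def mulRightOn (hx : x ∈ J) (z : ℂ) : J →ₗ[A] J :=
  (LinearMap.toSpanSingleton A A (algebraMap ℂ A z - x)).restrict
    (fun _ hy => mul_algebraMap_sub_mem hx hy)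

lemma coe_mulRightOn (hx : x ∈ J) (y : J) :
    (mulRightOn hx z y : A) = y * (algebraMap ℂ A z - x) := rfl

lemma isUnit_of_left_inverse [IsNoetherian A J] (hx : x ∈ J) (hz : z ≠ 0 ∨ (1 : A) ∈ J) {s : A}
    (hs : s * (algebraMap ℂ A z - x) = 1) : IsUnit (algebraMap ℂ A z - x) := by
  have hsurj : Function.Surjective (mulRightOn hx z) := fun w => by
    have hw : (w : A) * s * (algebraMap ℂ A z - x) = w := by rw [mul_assoc, hs, mul_one]
    exact ⟨⟨w * s, mem_of_mul_algebraMap_sub_mem hx hz (by rw [hw]; exact w.2)⟩, Subtype.ext hw⟩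
  have hinj := IsNoetherian.injective_of_surjective_endomorphism _ hsurj
  have hk : ((algebraMap ℂ A z - x) * s - 1) * (algebraMap ℂ A z - x) = 0 := by
    rw [sub_mul, mul_assoc, hs, mul_one, one_mul, sub_self]
  have hmem := mem_of_mul_algebraMap_sub_mem hx hz (hk ▸ J.zero_mem)
  have h0 : (⟨_, hmem⟩ : J) = 0 := hinj (Subtype.ext (by rw [coe_mulRightOn, hk, map_zero]; rfl))
  exact ⟨⟨_, s, sub_eq_zero.1 (congrArg Subtype.val h0), hs⟩, rfl⟩

lemma isUnit_of_right_inverse [IsNoetherian A J] [IsArtinian A J] (hx : x ∈ J)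
    (hz : z ≠ 0 ∨ (1 : A) ∈ J) {t : A} (ht : (algebraMap ℂ A z - x) * t = 1) :
    IsUnit (algebraMap ℂ A z - x) := by
  have hinj : Function.Injective (mulRightOn hx z) := fun y w h => Subtype.ext <| by
    have := congrArg (fun y : J => (y : A) * t) h
    simpa [coe_mulRightOn, mul_assoc, ht] using this
  have hsurj := IsArtinian.surjective_of_injective_endomorphism _ hinj
  suffices ∃ s : A, s * (algebraMap ℂ A z - x) = 1 by
    obtain ⟨s, hs⟩ := this
    exact isUnit_of_left_inverse hx hz hs
  rcases hz with hz | hz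
  · obtain ⟨y, hy⟩ := hsurj ⟨x, hx⟩
    have hy' : (y : A) * (algebraMap ℂ A z - x) = x := congrArg Subtype.val hy
    refine ⟨algebraMap ℂ A z⁻¹ * (1 + y), ?_⟩
    rw [mul_assoc, add_mul, hy', one_mul, sub_add_cancel, ← map_mul, inv_mul_cancel₀ hz, map_one]
  · obtain ⟨y, hy⟩ := hsurj ⟨1, hz⟩
    exact ⟨y, congrArg Subtype.val hy⟩

end FiniteLength

section Telescoping

variable [Ring A] {u v : A} {c : ℕ → A}

lemma sum_mul_pow_telescope (hc : ∀ n, c (n + 1) = c n * v - u * c n) {t : A} (ht : v * t = 1)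
    (N : ℕ) : u * ∑ n ∈ Finset.range N, c n * t ^ (n + 1) = c 0 - c N * t ^ N := by
  induction N with
  | zero => simp
  | succ N ih =>
    have h : c N * v * t ^ (N + 1) = c N * t ^ N := by
      rw [pow_succ', mul_assoc, ← mul_assoc v, ht, one_mul]
    rw [Finset.sum_range_succ, mul_add, ih, hc N, sub_mul, h]
    noncomm_ring

lemma sum_pow_mul_telescope (hc : ∀ n, c (n + 1) = c n * v - u * c n) {s : A} (hs : s * u = 1)
    (N : ℕ) : (∑ n ∈ Finset.range N, (-1) ^ n * s ^ (n + 1) * c n) * v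
      = c 0 - (-1) ^ N * s ^ N * c N := by
  induction N with
  | zero => simp
  | succ N ih =>
    have h : s ^ (N + 1) * (u * c N) = s ^ N * c N := by
      rw [pow_succ, mul_assoc, ← mul_assoc s, hs, one_mul]
    rw [Finset.sum_range_succ, add_mul, ih, hc N, mul_sub, mul_assoc _ _ (u * c N), h, pow_succ]
    noncomm_ring

end Telescoping

section Banach

variable [NormedRing A] [NormedAlgebra ℂ A] {a b : A}

lemma Cop_pow_succ_one (a b : A) (z : ℂ) (n : ℕ) :
    (Cop a b ^ (n + 1)) 1 = (Cop a b ^ n) 1 * (algebraMap ℂ A z - b)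
      - (algebraMap ℂ A z - a) * (Cop a b ^ n) 1 := by
  rw [pow_succ', Module.End.mul_apply, mul_sub, sub_mul, Algebra.commutes]
  simp [Cop]

lemma norm_Cop_pow_one_le (a b : A) (n : ℕ) :
    ‖(Cop a b ^ n) 1‖ ≤ (‖a‖ + ‖b‖) ^ n * ‖(1 : A)‖ := by
  induction n with
  | zero => simp
  | succ n ih =>
    calc ‖(Cop a b ^ (n + 1)) 1‖
        = ‖a * (Cop a b ^ n) 1 - (Cop a b ^ n) 1 * b‖ := by
          rw [pow_succ', Module.End.mul_apply]; rfl
      _ ≤ ‖a‖ * ‖(Cop a b ^ n) 1‖ + ‖(Cop a b ^ n) 1‖ * ‖b‖ :=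
          (norm_sub_le _ _).trans (add_le_add (norm_mul_le _ _) (norm_mul_le _ _))
      _ = (‖a‖ + ‖b‖) * ‖(Cop a b ^ n) 1‖ := by ring
      _ ≤ (‖a‖ + ‖b‖) * ((‖a‖ + ‖b‖) ^ n * ‖(1 : A)‖) := by gcongr
      _ = _ := by ring

lemma eventually_norm_Cop_pow_one_le (h : rho a b = 0) {ε : ℝ} (hε : 0 < ε) :
    ∀ᶠ n in atTop, ‖(Cop a b ^ n) 1‖ ≤ ε ^ n := by
  have hbdd : IsBoundedUnder (· ≤ ·) atTop
      (fun n : ℕ => ‖(Cop a b ^ n) 1‖ ^ (1 / (n : ℝ))) := by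
    refine isBoundedUnder_of_eventually_le (a := (‖a‖ + ‖b‖) * (‖(1 : A)‖ + 1)) ?_
    filter_upwards [eventually_ge_atTop 1] with n hn
    rw [one_div, Real.rpow_inv_le_iff_of_pos (norm_nonneg _) (by positivity) (by positivity),
      Real.rpow_natCast, mul_pow]
    refine (norm_Cop_pow_one_le a b n).trans ?_
    gcongr
    calc ‖(1 : A)‖ ≤ ‖(1 : A)‖ + 1 := by linarith
      _ ≤ _ := le_self_pow₀ (by linarith [norm_nonneg (1 : A)]) (by omega)
  have hlt := eventually_lt_of_limsup_lt (h.trans_lt hε) hbdd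
  filter_upwards [hlt, eventually_ge_atTop 1] with n hn hn1
  rw [one_div, Real.rpow_inv_lt_iff_of_pos (norm_nonneg _) hε.le (by positivity),
    Real.rpow_natCast] at hn
  exact hn.le

lemma tendsto_pow_mul_norm_Cop_pow_one (h : rho a b = 0) {M : ℝ} (hM : 0 ≤ M) :
    Tendsto (fun n => M ^ n * ‖(Cop a b ^ n) 1‖) atTop (nhds 0) := by
  have hε : 0 < (2 * (M + 1))⁻¹ := by positivity
  refine squeeze_zero' (Eventually.of_forall fun n => by positivity) ?_
    (tendsto_pow_atTop_nhds_zero_of_lt_one (r := M * (2 * (M + 1))⁻¹) (by positivity) ?_)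
  · filter_upwards [eventually_norm_Cop_pow_one_le h hε] with n hn
    rw [mul_pow]
    gcongr
  · rw [← div_eq_mul_inv, div_lt_one (by positivity)]
    linarith

omit [NormedAlgebra ℂ A] in
/-- The bound `‖x ^ n‖ ≤ ‖x‖ ^ n` up to a constant, which also covers `n = 0`. -/
lemma norm_pow_le_const_mul (x : A) (n : ℕ) : ‖x ^ n‖ ≤ (‖(1 : A)‖ + 1) * ‖x‖ ^ n := by
  rcases Nat.eq_zero_or_pos n with rfl | hn
  · simp
  · calc ‖x ^ n‖ ≤ 1 * ‖x‖ ^ n := by rw [one_mul]; exact norm_pow_le' x hn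
      _ ≤ _ := by gcongr; linarith [norm_nonneg (1 : A)]

lemma exists_norm_pow_mul_norm_Cop_pow_lt (h : rho a b = 0) (s : A) :
    ∃ N, ‖s ^ N‖ * ‖(Cop a b ^ N) 1‖ < 1 := by
  have ht := (tendsto_pow_mul_norm_Cop_pow_one h (norm_nonneg s)).const_mul (‖(1 : A)‖ + 1)
  rw [mul_zero] at ht
  obtain ⟨N, hN⟩ := (ht.eventually_lt_const one_pos).exists
  refine ⟨N, lt_of_le_of_lt ?_ hN⟩
  rw [← mul_assoc]
  gcongr
  exact norm_pow_le_const_mul s N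

variable [CompleteSpace A]

lemma exists_left_inverse_of_rho_eq_zero (h : rho a b = 0) {z : ℂ}
    (hz : IsUnit (algebraMap ℂ A z - a)) : ∃ s : A, s * (algebraMap ℂ A z - b) = 1 := by
  obtain ⟨r, hr⟩ := hz.exists_left_inv
  obtain ⟨N, hN⟩ := exists_norm_pow_mul_norm_Cop_pow_lt h r
  have ht := sum_pow_mul_telescope (c := fun n => (Cop a b ^ n) 1) (Cop_pow_succ_one a b z) hr N
  have hu : IsUnit ((1 : A) - (-1) ^ N * r ^ N * (Cop a b ^ N) 1) := by
    apply isUnit_one_sub_of_norm_lt_one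
    refine lt_of_le_of_lt ?_ hN
    rcases neg_one_pow_eq_or A N with e | e <;> simpa [e] using norm_mul_le _ _
  obtain ⟨w, hw⟩ := hu.exists_left_inv
  exact ⟨w * _, by rw [mul_assoc, ht, pow_zero, Module.End.one_apply, hw]⟩

lemma exists_right_inverse_of_rho_eq_zero (h : rho a b = 0) {z : ℂ}
    (hz : IsUnit (algebraMap ℂ A z - b)) : ∃ t : A, (algebraMap ℂ A z - a) * t = 1 := by
  obtain ⟨r, hr⟩ := hz.exists_right_inv
  obtain ⟨N, hN⟩ := exists_norm_pow_mul_norm_Cop_pow_lt h r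
  have ht := sum_mul_pow_telescope (c := fun n => (Cop a b ^ n) 1) (Cop_pow_succ_one a b z) hr N
  have hu : IsUnit ((1 : A) - (Cop a b ^ N) 1 * r ^ N) := by
    apply isUnit_one_sub_of_norm_lt_one
    refine lt_of_le_of_lt (norm_mul_le _ _) ?_
    rwa [mul_comm]
  obtain ⟨w, hw⟩ := hu.exists_right_inv
  exact ⟨_ * w, by rw [← mul_assoc, ht, pow_zero, Module.End.one_apply, hw]⟩

lemma spectrum_eq_of_rho_eq_zero (ha : a ∈ socle A) (hb : b ∈ socle A) (h : rho a b = 0) :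
    spectrum ℂ a = spectrum ℂ b := by
  obtain ⟨I, haI, _, _⟩ := exists_finite_length_of_mem_socle ha
  obtain ⟨J, hbJ, _, _⟩ := exists_finite_length_of_mem_socle hb
  have haK : a ∈ I ⊔ J := Ideal.mem_sup_left haI
  have hbK : b ∈ I ⊔ J := Ideal.mem_sup_right hbJ
  have _ := isNoetherian_sup I J
  have _ := isArtinian_sup I J
  have hz {x : A} (hx : x ∈ I ⊔ J) {z : ℂ} (hu : IsUnit (algebraMap ℂ A z - x)) :
      z ≠ 0 ∨ (1 : A) ∈ I ⊔ J := by
    refine or_iff_not_imp_left.2 fun h0 => ?_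
    obtain rfl : z = 0 := not_not.1 h0
    rw [map_zero, zero_sub] at hu
    exact (Ideal.eq_top_iff_one _).1 (Ideal.eq_top_of_isUnit_mem _ (neg_mem hx) hu)
  ext z
  rw [spectrum.mem_iff, spectrum.mem_iff, not_iff_not]
  constructor
  · intro hu
    obtain ⟨s, hs⟩ := exists_left_inverse_of_rho_eq_zero h hu
    exact isUnit_of_left_inverse hbK (hz haK hu) hs
  · intro hu
    obtain ⟨t, ht⟩ := exists_right_inverse_of_rho_eq_zero h hu
    exact isUnit_of_right_inverse haK (hz hbK hu) ht

lemma hasDerivAt_resolvent_pow {z : ℂ} (hz : z ∈ resolventSet ℂ b) (n : ℕ) :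
    HasDerivAt (fun w => resolvent b w ^ n) (-(n : ℂ) • resolvent b z ^ (n + 1)) z := by
  induction n with
  | zero => simpa using hasDerivAt_const z (1 : A)
  | succ n ih =>
    have := ih.mul (spectrum.hasDerivAt_resolvent_const_left hz)
    convert this using 1
    · ext w; simp [pow_succ]
    · rw [mul_neg, ← pow_add, smul_mul_assoc, ← pow_succ, ← sub_eq_add_neg]
      push_cast
      module

lemma circleIntegral_resolvent_pow_eq_zero {lam : ℂ} {r : ℝ} (hr : 0 ≤ r)
    (hs : ∀ z ∈ sphere lam r, z ∈ resolventSet ℂ b) (c : A) {n : ℕ} (hn : n ≠ 0) :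
    (∮ z in C(lam, r), c * resolvent b z ^ (n + 1)) = 0 := by
  refine circleIntegral.integral_eq_zero_of_hasDerivWithinAt
    (f := fun z => (-(n : ℂ))⁻¹ • (c * resolvent b z ^ n)) hr fun z hz => ?_
  have := ((hasDerivAt_resolvent_pow (hs z hz) n).const_mul c).const_smul (-(n : ℂ))⁻¹
  rw [mul_smul_comm, inv_smul_smul₀ (by simpa using hn)] at this
  exact this.hasDerivWithinAt

lemma continuousOn_resolvent_pow {S : Set ℂ} (hs : ∀ z ∈ S, z ∈ resolventSet ℂ b) (n : ℕ) :
    ContinuousOn (fun z => resolvent b z ^ n) S :=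
  fun z hz => (hasDerivAt_resolvent_pow (hs z hz) n).continuousAt.continuousWithinAt

lemma continuousOn_resolvent {S : Set ℂ} (hs : ∀ z ∈ S, z ∈ resolventSet ℂ b) :
    ContinuousOn (resolvent b) S := by
  simpa using continuousOn_resolvent_pow hs 1

lemma circleIntegrable_mul_resolvent_pow {lam : ℂ} {r : ℝ} (hr : 0 ≤ r)
    (hs : ∀ z ∈ sphere lam r, z ∈ resolventSet ℂ b) (c : A) (n : ℕ) :
    CircleIntegrable (fun z => c * resolvent b z ^ n) lam r :=
  (continuousOn_const.mul (continuousOn_resolvent_pow hs n)).circleIntegrable hr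

lemma circleIntegral_sum_resolvent_pow {lam : ℂ} {r : ℝ} (hr : 0 ≤ r)
    (hs : ∀ z ∈ sphere lam r, z ∈ resolventSet ℂ b) (c : ℕ → A) (N : ℕ) :
    (∮ z in C(lam, r), ∑ n ∈ Finset.range (N + 1), c n * resolvent b z ^ (n + 1))
      = ∮ z in C(lam, r), c 0 * resolvent b z := by
  rw [circleIntegral.integral_fun_sum fun n _ =>
    circleIntegrable_mul_resolvent_pow hr hs (c n) (n + 1),
    Finset.sum_range_succ', Finset.sum_eq_zero fun n _ =>
      circleIntegral_resolvent_pow_eq_zero hr hs _ n.succ_ne_zero]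
  simp

lemma circleIntegral_resolvent_eq (h : rho a b = 0) {lam : ℂ} {r : ℝ} (hr : 0 ≤ r)
    (hsa : ∀ z ∈ sphere lam r, z ∈ resolventSet ℂ a)
    (hsb : ∀ z ∈ sphere lam r, z ∈ resolventSet ℂ b) :
    (∮ z in C(lam, r), resolvent a z) = ∮ z in C(lam, r), resolvent b z := by
  set c : ℕ → A := fun n => (Cop a b ^ n) 1 with hc
  obtain ⟨Ma, hMa⟩ := (isCompact_sphere lam r).exists_bound_of_continuousOn
    (continuousOn_resolvent hsa)
  obtain ⟨M₀, hMb⟩ := (isCompact_sphere lam r).exists_bound_of_continuousOn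
    (continuousOn_resolvent hsb)
  set M := max M₀ 0
  have hM : 0 ≤ M := le_max_right _ _
  have hkey (N : ℕ) (z : ℂ) (hz : z ∈ sphere lam r) :
      resolvent a z - ∑ n ∈ Finset.range (N + 1), c n * resolvent b z ^ (n + 1)
        = resolvent a z * (c (N + 1) * resolvent b z ^ (N + 1)) := by
    have h1 : (algebraMap ℂ A z - b) * resolvent b z = 1 := Ring.mul_inverse_cancel _ (hsb z hz)
    have h2 : resolvent a z * (algebraMap ℂ A z - a) = 1 := Ring.inverse_mul_cancel _ (hsa z hz)
    have := congrArg (resolvent a z * ·)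
      (sum_mul_pow_telescope (c := c) (Cop_pow_succ_one a b z) h1 (N + 1))
    simp only [← mul_assoc, h2, one_mul] at this
    rw [this]
    simp [hc, mul_sub]
  have hle (N : ℕ) : ‖(∮ z in C(lam, r), resolvent a z) - ∮ z in C(lam, r), resolvent b z‖
      ≤ 2 * Real.pi * r * (Ma * (M ^ (N + 1) * ‖c (N + 1)‖)) := by
    have hb := circleIntegral_sum_resolvent_pow hr hsb c N
    simp only [hc, pow_zero, Module.End.one_apply, one_mul] at hb
    rw [← hb, ← circleIntegral.integral_sub
      ((continuousOn_resolvent hsa).circleIntegrable hr)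
      (CircleIntegrable.fun_sum _ fun n _ =>
        circleIntegrable_mul_resolvent_pow hr hsb _ (n + 1))]
    refine circleIntegral.norm_integral_le_of_norm_le_const hr fun z hz => ?_
    rw [hkey N z hz]
    have hMa0 : 0 ≤ Ma := (norm_nonneg _).trans (hMa z hz)
    calc ‖resolvent a z * (c (N + 1) * resolvent b z ^ (N + 1))‖
        ≤ ‖resolvent a z‖ * (‖c (N + 1)‖ * ‖resolvent b z ^ (N + 1)‖) :=
          (norm_mul_le _ _).trans (by gcongr; exact norm_mul_le _ _)
      _ ≤ Ma * (‖c (N + 1)‖ * M ^ (N + 1)) := by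
          gcongr
          · exact hMa z hz
          · refine (norm_pow_le' _ N.succ_pos).trans ?_
            gcongr
            exact (hMb z hz).trans (le_max_left _ _)
      _ = _ := by ring
  have hlim := ((((tendsto_pow_mul_norm_Cop_pow_one h hM).comp (tendsto_add_atTop_nat 1)).const_mul
    Ma).const_mul (2 * Real.pi * r))
  rw [mul_zero, mul_zero] at hlim
  exact sub_eq_zero.1 (norm_le_zero_iff.1 (ge_of_tendsto' hlim hle))

/-- Elements with equal spectra and `ρ(a, b) = 0` have the same Riesz projections. -/
lemma rieszIdem_eq_of_rho_eq_zero (h : rho a b = 0) (hspec : spectrum ℂ a = spectrum ℂ b)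
    (lam : ℂ) : rieszIdem a lam = rieszIdem b lam := by
  by_cases hb : ∃ r : ℝ, 0 < r ∧ spectrum ℂ b ∩ closedBall lam r = {lam}
  · have ha : ∃ r : ℝ, 0 < r ∧ spectrum ℂ a ∩ closedBall lam r = {lam} := by rwa [hspec]
    have hch : ha.choose = hb.choose := by congr! 3; rw [hspec]
    rw [rieszIdem, rieszIdem, dif_pos ha, dif_pos hb, hch]
    obtain ⟨hr0, hr1⟩ := hb.choose_spec
    have hs : ∀ z ∈ sphere lam hb.choose, z ∉ spectrum ℂ b := fun z hz hz' => by
      have hzl : z ∈ ({lam} : Set ℂ) := hr1 ▸ ⟨hz', sphere_subset_closedBall hz⟩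
      rw [Set.mem_singleton_iff.1 hzl, mem_sphere, dist_self] at hz
      exact hr0.ne hz
    exact congrArg _ (circleIntegral_resolvent_eq h hr0.le
      (fun z hz => not_not.1 (hspec ▸ hs z hz : z ∉ spectrum ℂ a))
      (fun z hz => not_not.1 (hs z hz)))
  · have ha : ¬∃ r : ℝ, 0 < r ∧ spectrum ℂ a ∩ closedBall lam r = {lam} := by rwa [hspec]
    rw [rieszIdem, rieszIdem, dif_neg ha, dif_neg hb]

end Banach

theorem stmt12 [NormedRing A] [NormedAlgebra ℂ A] [CompleteSpace A]
    (hA : IsSemisimpleBA A) (a b : A) (ha : a ∈ socle A) (hb : b ∈ socle A)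
    (h : rho a b = 0) :
    spectrum ℂ a \ {0} = spectrum ℂ b \ {0} ∧
      ∀ lam ∈ spectrum ℂ a \ {0}, sMult a lam = sMult b lam := by
  have hspec := spectrum_eq_of_rho_eq_zero ha hb h
  exact ⟨by rw [hspec], fun lam _ => by rw [sMult, sMult, rieszIdem_eq_of_rho_eq_zero h hspec]⟩
end
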